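/- Euler's theorem on double zeta values: if n ≥ 2 and m ≥ 1 with n + m odd and n ≥ 2 (so the double series converges), then ζ(m, n) := Σ_{i₂ > i₁ ≥ 1} 1/(i₂^n · i₁^m) is a ℚ-linear combination of ζ(n+m) and products ζ(a)·ζ(b) with a + b = n + m, a, b ≥ 2. Concretely: ζ(m,n) = ½[ (−1)^m C(n+m, m) − 1 ] ζ(n+m) + (1−(−1)^m)/2 · ζ(m)ζ(n) − (−1)^m Σ_{0<2k<n+m} [ C(n+m−2k−1, n−1) + C(n+m−2k−1, m−1) ] ζ(2k) ζ(n+m−2k) ... (weak form: ζ(m,n) lies in the ℚ-span of ζ(n+m) and the products ζ(a)ζ(b), a+b = n+m, a,b ≥ 2). -/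

import Mathlib

/-- `ζ(s) = ∑_{i ≥ 1} i^{−s}`. -/
noncomputable def zetaVal (s : ℕ) : ℝ := ∑' i : ℕ, 1 / ((i : ℝ) + 1) ^ s

/-- Double zeta value `ζ(m,n) = ∑_{i₂ > i₁ ≥ 1} i₁^{−m} i₂^{−n}`. -/
noncomputable def doubleZeta (m n : ℕ) : ℝ :=
  ∑' q : {q : ℕ × ℕ // 0 < q.1 ∧ q.1 < q.2}, 1 / ((q.val.1 : ℝ) ^ m * (q.val.2 : ℝ) ^ n)

open Finset

lemma ez_congr {ι : Type} {f g : ι → ℝ} {x y : ℝ} (h : HasSum f x) (hf : ∀ k, g k = f k) (hx : y = x) :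
    HasSum g y := by
  rw [hx, funext hf]; exact h

noncomputable def ezAt (a b k i : ℕ) : ℝ := ((-((i:ℝ)+1))^a * ((k:ℝ)+i+2)^b)⁻¹
noncomputable def ezBt (a b k j : ℕ) : ℝ := (((j:ℝ)+1)^a * ((k:ℝ)-j)^b)⁻¹
noncomputable def ezU (a b k : ℕ) : ℝ :=
  ∑' i, ezAt a b k i + ∑ j ∈ range k, ezBt a b k j + ∑' i, ezAt b a k i
noncomputable def ezH (k : ℕ) : ℝ := ∑ j ∈ range k, 1 / ((j:ℝ)+1)

lemma ez_summable (a : ℕ) (ha : 2 ≤ a) : Summable (fun i : ℕ => 1 / ((i:ℝ)+1)^a) := by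
  have h := (summable_nat_add_iff 1).2 (Real.summable_one_div_nat_pow.2 (show 1 < a by omega))
  simpa using h

lemma ez_hasSum (a : ℕ) (ha : 2 ≤ a) : HasSum (fun i : ℕ => 1 / ((i:ℝ)+1)^a) (zetaVal a) :=
  (ez_summable a ha).hasSum

lemma ezAt_summable (a b k : ℕ) (h : 2 ≤ a + b) : Summable (ezAt a b k) := by
  refine Summable.of_norm_bounded (ez_summable (a+b) h) (fun i => ?_)
  unfold ezAt
  have h1 : (0:ℝ) < (i:ℝ)+1 := by positivity
  rw [norm_inv, norm_mul, norm_pow, norm_neg, norm_pow, Real.norm_of_nonneg h1.le,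
    Real.norm_of_nonneg (by positivity), ← one_div, pow_add]
  have h2 : (i:ℝ)+1 ≤ (k:ℝ)+i+2 := by linarith [(Nat.cast_nonneg k : (0:ℝ) ≤ k)]
  gcongr

lemma ez_pf (x y K : ℝ) (hx : x ≠ 0) (hy : y ≠ 0) (hK : K ≠ 0) (h : x + y = K) (a b : ℕ) :
    (x^(a+1) * y^(b+1))⁻¹ = ((x^a * y^(b+1))⁻¹ + (x^(a+1)*y^b)⁻¹) / K := by
  subst h
  field_simp
  ring

lemma ezAt_rec (a b k i : ℕ) :
    ezAt (a+1) (b+1) k i = (ezAt a (b+1) k i + ezAt (a+1) b k i) / ((k:ℝ)+1) := by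
  unfold ezAt
  have h1 : (0:ℝ) < (i:ℝ)+1 := by positivity
  exact ez_pf _ _ _ (neg_ne_zero.2 h1.ne') (by positivity) (by positivity) (by ring) a b

lemma ezBt_rec (a b k j : ℕ) (hj : j < k) :
    ezBt (a+1) (b+1) k j = (ezBt a (b+1) k j + ezBt (a+1) b k j) / ((k:ℝ)+1) := by
  unfold ezBt
  have h1 : (j:ℝ) < k := by exact_mod_cast hj
  exact ez_pf _ _ _ (by positivity) (by linarith) (by positivity) (by ring) a b

lemma ezU_rec (a b k : ℕ) (h : 1 ≤ a + b) :
    ezU (a+1) (b+1) k = (ezU a (b+1) k + ezU (a+1) b k) / ((k:ℝ)+1) := by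
  unfold ezU
  have e : ∀ a b : ℕ, 1 ≤ a + b → ∑' i, ezAt (a+1) (b+1) k i
      = (∑' i, ezAt a (b+1) k i + ∑' i, ezAt (a+1) b k i) / ((k:ℝ)+1) := by
    intro a b h
    simp_rw [ezAt_rec]
    rw [tsum_div_const, Summable.tsum_add (ezAt_summable _ _ _ (by omega))
      (ezAt_summable _ _ _ (by omega))]
  rw [e a b h, e b a (by omega), Finset.sum_congr rfl
    (fun j hj => ezBt_rec a b k j (mem_range.1 hj)), ← Finset.sum_div, Finset.sum_add_distrib]
  ring

lemma ezU_symm (a b k : ℕ) : ezU a b k = ezU b a k := by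
  unfold ezU
  have : ∑ j ∈ range k, ezBt a b k j = ∑ j ∈ range k, ezBt b a k j := by
    rw [← Finset.sum_range_reflect]
    refine Finset.sum_congr rfl (fun j hj => ?_)
    have hj := mem_range.1 hj
    unfold ezBt
    have : ((k - 1 - j : ℕ) : ℝ) = (k:ℝ) - 1 - j := by
      rw [Nat.cast_sub (by omega), Nat.cast_sub (by omega)]; simp
    rw [this, mul_comm]
    ring_nf
  rw [this]; ring

lemma ezU_zero (a k : ℕ) (ha : 2 ≤ a) :
    ezU a 0 k = (1 + (-1)^a) * zetaVal a - 1 / ((k:ℝ)+1)^a := by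
  have h1 : ∑' i, ezAt a 0 k i = (-1)^a * zetaVal a := by
    unfold zetaVal
    rw [← tsum_mul_left]
    refine tsum_congr (fun i => ?_)
    unfold ezAt
    rw [neg_pow]
    have : ((-1:ℝ)^a)⁻¹ = (-1)^a := by rw [← inv_pow]; norm_num
    rw [pow_zero, mul_one, mul_inv, this, one_div]
  have h2 := (ez_summable a ha).sum_add_tsum_nat_add (k+1)
  have h3 : ∑' i, ezAt 0 a k i = ∑' i : ℕ, 1 / (((i + (k+1) : ℕ):ℝ)+1)^a := by
    refine tsum_congr (fun i => ?_)
    unfold ezAt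
    push_cast
    rw [pow_zero, one_mul, one_div]
    ring_nf
  have h4 : ∑ j ∈ range k, ezBt a 0 k j = ∑ j ∈ range k, 1 / ((j:ℝ)+1)^a := by
    refine Finset.sum_congr rfl (fun j _ => ?_)
    simp [ezBt]
  unfold ezU
  rw [h1, h3, h4]
  rw [Finset.sum_range_succ] at h2
  have : zetaVal a = ∑' i : ℕ, 1 / ((i:ℝ)+1)^a := rfl
  rw [← this] at h2
  linarith

lemma ez_tele1 (K : ℕ) : HasSum (fun i : ℕ => 1 / ((i:ℝ)+K+1) - 1 / ((i:ℝ)+K+2)) (1/((K:ℝ)+1)) := by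
  rw [hasSum_iff_tendsto_nat_of_nonneg]
  · have h : ∀ n : ℕ, ∑ i ∈ range n, (1 / ((i:ℝ)+K+1) - 1 / ((i:ℝ)+K+2))
        = 1/((K:ℝ)+1) - 1 / (((n+K:ℕ):ℝ)+1) := by
      intro n
      induction n with
      | zero => simp
      | succ n ih => rw [Finset.sum_range_succ, ih]; push_cast; ring_nf
    simp_rw [h]
    have := (tendsto_one_div_add_atTop_nhds_zero_nat (𝕜 := ℝ)).comp (Filter.tendsto_add_atTop_nat K)
    simpa [Function.comp_def] using this.const_sub (1/((K:ℝ)+1))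
  · intro i
    rw [sub_nonneg]
    gcongr
    norm_num

lemma ez_tele (K : ℕ) : HasSum (fun i : ℕ => 1 / ((i:ℝ)+1) - 1 / ((i:ℝ)+K+1)) (ezH K) := by
  induction K with
  | zero => simp [ezH]
  | succ K ih =>
    have := ih.add (ez_tele1 K)
    unfold ezH at *
    rw [Finset.sum_range_succ]
    refine ez_congr this (fun i => ?_) rfl
    push_cast
    ring

lemma ez_tele' (k : ℕ) : HasSum (fun i : ℕ => 1 / (((i:ℝ)+1) * ((k:ℝ)+i+2))) (ezH (k+1) / (k+1)) := by
  have := (ez_tele (k+1)).div_const ((k:ℝ)+1)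
  refine ez_congr this (fun i => ?_) rfl
  push_cast
  have h1 : (i:ℝ)+1 ≠ 0 := by positivity
  have h2 : (i:ℝ)+(k+1)+1 ≠ 0 := by positivity
  have h3 : (k:ℝ)+i+2 ≠ 0 := by positivity
  field_simp
  ring

lemma ezU_one (k : ℕ) : ezU 1 1 k = -2 / ((k:ℝ)+1)^2 := by
  have h1 : ∑' i, ezAt 1 1 k i = - (ezH (k+1) / (k+1)) := by
    rw [← (ez_tele' k).tsum_eq, ← tsum_neg]
    refine tsum_congr (fun i => ?_)
    unfold ezAt
    rw [pow_one, pow_one, neg_mul, inv_neg, one_div]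
  have h2 : ∑ j ∈ range k, ezBt 1 1 k j = 2 * ezH k / (k+1) := by
    have e : ∑ j ∈ range k, 1 / ((k:ℝ) - j) = ezH k := by
      unfold ezH
      rw [← Finset.sum_range_reflect]
      refine Finset.sum_congr rfl (fun j hj => ?_)
      have hj := mem_range.1 hj
      have : ((k - 1 - j : ℕ) : ℝ) = (k:ℝ) - 1 - j := by
        rw [Nat.cast_sub (by omega), Nat.cast_sub (by omega)]; simp
      rw [this]
      ring_nf
    rw [Finset.sum_congr rfl (fun j hj => ezBt_rec 0 0 k j (mem_range.1 hj)),
      ← Finset.sum_div, Finset.sum_add_distrib]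
    have e1 : ∑ x ∈ range k, ezBt 0 (0 + 1) k x = ezH k := by rw [← e]; simp [ezBt]
    have e2 : ∑ x ∈ range k, ezBt (0 + 1) 0 k x = ezH k := by simp [ezBt, ezH]
    rw [e1, e2, two_mul]
  unfold ezU
  rw [h1, h2]
  have : ezH (k+1) = ezH k + 1 / ((k:ℝ)+1) := by unfold ezH; rw [Finset.sum_range_succ]
  rw [this]
  field_simp
  ring

noncomputable def ezS (w : ℕ) : Submodule ℚ ℝ := Submodule.span ℚ
      ({zetaVal w} ∪
        {x : ℝ | ∃ a b : ℕ, 2 ≤ a ∧ 2 ≤ b ∧ a + b = w ∧ x = zetaVal a * zetaVal b})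

lemma ezS_zeta (w : ℕ) : zetaVal w ∈ ezS w := Submodule.subset_span (Or.inl rfl)
lemma ezS_prod (w a b : ℕ) (ha : 2 ≤ a) (hb : 2 ≤ b) (h : a + b = w) :
    zetaVal a * zetaVal b ∈ ezS w := Submodule.subset_span (Or.inr ⟨a, b, ha, hb, h, rfl⟩)
lemma ezS_smul (w : ℕ) (q : ℚ) {x : ℝ} (h : x ∈ ezS w) : (q:ℝ) * x ∈ ezS w := by
  have := (ezS w).smul_mem q h
  rwa [Rat.smul_def] at this

lemma ez_base (w a c : ℕ) (ha : 2 ≤ a) (hc : 2 ≤ c) (h : a + c = w) :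
    ∃ x ∈ ezS w, HasSum (fun k : ℕ => ezU a 0 k / ((k:ℝ)+1)^c) x := by
  refine ⟨((1 + (-1)^a : ℚ):ℝ) * (zetaVal a * zetaVal c) - zetaVal w, ?_, ?_⟩
  · exact (ezS w).sub_mem (ezS_smul _ _ (ezS_prod w a c ha hc h)) (ezS_zeta w)
  · have h1 := (ez_hasSum c hc).mul_left ((1 + (-1)^a) * zetaVal a)
    have h2 := h1.sub (ez_hasSum w (by omega))
    refine ez_congr h2 (fun k => ?_) ?_
    · rw [ezU_zero a k ha, ← h, pow_add]
      field_simp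
    · push_cast; ring

lemma ez_main (w : ℕ) : ∀ N a b c : ℕ, a + b = N → 2 ≤ a + b → 2 ≤ a + c → 2 ≤ b + c →
    a + b + c = w → ∃ x ∈ ezS w, HasSum (fun k : ℕ => ezU a b k / ((k:ℝ)+1)^c) x := by
  intro N
  induction N with
  | zero => intros; omega
  | succ N ih =>
    intro a b c hN h1 h2 h3 hw
    rcases Nat.eq_zero_or_pos b with rfl | hb
    · exact ez_base w a c (by omega) (by omega) (by omega)
    rcases Nat.eq_zero_or_pos a with rfl | ha
    · simp_rw [ezU_symm 0 b]
      exact ez_base w b c (by omega) (by omega) (by omega)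
    by_cases h11 : a + b = 2
    · obtain rfl : a = 1 := by omega
      obtain rfl : b = 1 := by omega
      refine ⟨((-2:ℚ):ℝ) * zetaVal w, ezS_smul _ _ (ezS_zeta w), ?_⟩
      refine ez_congr ((ez_hasSum w (by omega)).mul_left (((-2:ℚ):ℝ))) (fun k => ?_) rfl
      rw [ezU_one, ← hw, pow_add]
      push_cast
      field_simp
    · obtain ⟨a, rfl⟩ : ∃ a', a = a' + 1 := ⟨a-1, by omega⟩
      obtain ⟨b, rfl⟩ : ∃ a', b = a' + 1 := ⟨b-1, by omega⟩
      obtain ⟨x, hx, hx'⟩ := ih a (b+1) (c+1) (by omega) (by omega) (by omega) (by omega) (by omega)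
      obtain ⟨y, hy, hy'⟩ := ih (a+1) b (c+1) (by omega) (by omega) (by omega) (by omega) (by omega)
      refine ⟨x + y, (ezS w).add_mem hx hy, ?_⟩
      refine ez_congr (hx'.add hy') (fun k => ?_) rfl
      rw [ezU_rec a b k (by omega), pow_succ]
      field_simp

noncomputable def ezD (m n : ℕ) (p : ℕ × ℕ) : ℝ :=
  1 / (((p.1:ℝ)+1)^m * ((p.1:ℝ)+p.2+2)^n)

lemma ez_doubleZeta (m n : ℕ) : doubleZeta m n = ∑' p, ezD m n p := by
  unfold doubleZeta
  let e : ℕ × ℕ ≃ {q : ℕ × ℕ // 0 < q.1 ∧ q.1 < q.2} :=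
    { toFun := fun p => ⟨(p.1+1, p.1+p.2+2), by constructor <;> dsimp only <;> omega⟩
      invFun := fun q => (q.1.1 - 1, q.1.2 - q.1.1 - 1)
      left_inv := by rintro ⟨a, b⟩; simp; omega
      right_inv := by
        rintro ⟨⟨a, b⟩, h1, h2⟩
        simp only [Subtype.mk.injEq, Prod.mk.injEq] at *
        omega }
  rw [← e.tsum_eq]
  refine tsum_congr (fun p => ?_)
  simp [e, ezD]

lemma ez_summ_xy : Summable (fun p : ℕ × ℕ => 1 / (((p.1:ℝ)+1) * ((p.2:ℝ)+1) * ((p.1:ℝ)+p.2+2))) := by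
  have h1 : Summable (fun i : ℕ => 1 / (((i:ℝ)+1) * Real.sqrt ((i:ℝ)+1))) := by
    have h := (summable_nat_add_iff 1).2
      (Real.summable_one_div_nat_rpow.2 (show (1:ℝ) < 3/2 by norm_num))
    refine h.congr (fun i => ?_)
    have hp : (0:ℝ) < (i:ℝ)+1 := by positivity
    push_cast
    rw [Real.sqrt_eq_rpow, show (3/2:ℝ) = 1 + 1/2 by norm_num, Real.rpow_add hp, Real.rpow_one]
  have h2 := h1.mul_of_nonneg h1 (fun i => by positivity) (fun i => by positivity)
  refine Summable.of_nonneg_of_le (fun p => by positivity) (fun p => ?_) h2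
  have hx : (0:ℝ) < (p.1:ℝ)+1 := by positivity
  have hy : (0:ℝ) < (p.2:ℝ)+1 := by positivity
  have e : Real.sqrt ((p.1:ℝ)+1) * Real.sqrt ((p.2:ℝ)+1) ≤ (p.1:ℝ)+p.2+2 := by
    nlinarith [Real.sq_sqrt hx.le, Real.sq_sqrt hy.le,
      sq_nonneg (Real.sqrt ((p.1:ℝ)+1) - Real.sqrt ((p.2:ℝ)+1))]
  rw [← one_div_mul_one_div_rev]
  rw [one_div_mul_one_div_rev, div_mul_div_comm, one_mul]
  apply one_div_le_one_div_of_le (by positivity)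
  calc _ = (((p.1:ℝ)+1) * ((p.2:ℝ)+1)) * (Real.sqrt ((p.1:ℝ)+1) * Real.sqrt ((p.2:ℝ)+1)) := by ring
    _ ≤ (((p.1:ℝ)+1) * ((p.2:ℝ)+1)) * ((p.1:ℝ)+p.2+2) := by gcongr
    _ = _ := by ring

lemma ezD_summable (m n : ℕ) (hm : 1 ≤ m) (hn : 2 ≤ n) : Summable (ezD m n) := by
  refine Summable.of_nonneg_of_le (fun p => by unfold ezD; positivity) (fun p => ?_) ez_summ_xy
  unfold ezD
  have hx : (1:ℝ) ≤ (p.1:ℝ)+1 := by simp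
  have hz : (1:ℝ) ≤ (p.1:ℝ)+p.2+2 := by
    have : (0:ℝ) ≤ (p.1:ℝ)+p.2 := by positivity
    linarith
  have hyz : (p.2:ℝ)+1 ≤ (p.1:ℝ)+p.2+2 := by
    have : (0:ℝ) ≤ (p.1:ℝ) := by positivity
    linarith
  apply one_div_le_one_div_of_le (by positivity)
  have h1 := pow_le_pow_right₀ hx hm
  have h2 := pow_le_pow_right₀ hz hn
  rw [pow_one] at h1
  rw [mul_assoc]
  refine mul_le_mul h1 (le_trans ?_ h2) (by positivity) (by positivity)
  rw [sq]
  gcongr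

noncomputable def ezT (N : ℕ) (p : ℕ × ℕ) : ℝ :=
  1 / (((p.1:ℝ)+1)^N * (((p.2:ℝ)+1) * ((p.1:ℝ)+p.2+2)))

lemma ezT_summable (N : ℕ) (hN : 1 ≤ N) : Summable (ezT N) := by
  refine Summable.of_nonneg_of_le (fun p => by unfold ezT; positivity) (fun p => ?_) ez_summ_xy
  unfold ezT
  have hx : (1:ℝ) ≤ (p.1:ℝ)+1 := by simp
  apply one_div_le_one_div_of_le (by positivity)
  have h1 := pow_le_pow_right₀ hx hN
  rw [pow_one] at h1
  rw [mul_assoc]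
  gcongr

lemma ez_antidiag {f : ℕ × ℕ → ℝ} (hf : Summable f) :
    HasSum (fun n => ∑ j ∈ range n, f (j, n - 1 - j)) (∑' p, f p) := by
  have h1 : HasSum (fun n => ∑ kl ∈ antidiagonal n, f kl) (∑' p, f p) := by
    have h := (Finset.HasAntidiagonal.sigmaAntidiagonalEquivProd.hasSum_iff).2 hf.hasSum
    refine h.sigma (fun n => ?_)
    have := hasSum_fintype (fun c : antidiagonal n => f c.1)
    rw [Finset.sum_coe_sort (antidiagonal n) f] at this
    exact this
  rw [← hasSum_nat_add_iff' 1]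
  refine ez_congr h1 (fun n => ?_) (by simp)
  rw [Finset.Nat.sum_antidiagonal_eq_sum_range_succ_mk]
  rfl

lemma ez_split {F : ℕ × ℕ → ℝ} {x y z : ℝ} (h1 : HasSum (fun p : ℕ × ℕ => F (p.1, p.1+p.2+1)) x)
    (h2 : HasSum (fun p : ℕ × ℕ => F (p.1+p.2+1, p.1)) y) (h3 : HasSum (fun i : ℕ => F (i, i)) z) :
    HasSum F (x + (y + z)) := by
  have hb : Function.Bijective (Sum.elim (fun p : ℕ × ℕ => (p.1, p.1+p.2+1))
      (Sum.elim (fun p : ℕ × ℕ => (p.1+p.2+1, p.1)) (fun i : ℕ => (i, i)))) := by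
    constructor
    · rintro (⟨a, b⟩ | ⟨a, b⟩ | a) (⟨c, d⟩ | ⟨c, d⟩ | c) h <;> simp at h ⊢ <;> omega
    · rintro ⟨a, b⟩
      rcases lt_trichotomy a b with h | h | h
      · exact ⟨Sum.inl (a, b - a - 1), by simp; omega⟩
      · exact ⟨Sum.inr (Sum.inr a), by simp [h]⟩
      · exact ⟨Sum.inr (Sum.inl (b, a - b - 1)), by simp; omega⟩
  rw [← (Equiv.ofBijective _ hb).hasSum_iff]
  exact HasSum.sum h1 (HasSum.sum h2 h3)

lemma ez_stuffle (m n : ℕ) (hm : 2 ≤ m) (hn : 2 ≤ n) :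
    zetaVal m * zetaVal n = doubleZeta m n + doubleZeta n m + zetaVal (m+n) := by
  have hs := (ez_summable m hm).mul_of_nonneg (ez_summable n hn)
    (fun i => by positivity) (fun i => by positivity)
  have h0 : HasSum (fun x : ℕ × ℕ => 1 / ((x.1:ℝ)+1)^m * (1 / ((x.2:ℝ)+1)^n))
      (zetaVal m * zetaVal n) := (ez_hasSum m hm).mul (ez_hasSum n hn) hs
  rw [add_assoc]
  refine h0.unique (ez_split ?_ ?_ ?_)
  · rw [ez_doubleZeta]
    refine ez_congr (ezD_summable m n (by omega) hn).hasSum (fun p => ?_) rfl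
    simp only [ezD]
    push_cast
    rw [one_div_mul_one_div]
    ring_nf
  · rw [ez_doubleZeta]
    refine ez_congr (ezD_summable n m (by omega) hm).hasSum (fun p => ?_) rfl
    simp only [ezD]
    push_cast
    rw [one_div_mul_one_div]
    ring_nf
  · refine ez_congr (ez_hasSum (m+n) (by omega)) (fun p => ?_) rfl
    rw [one_div_mul_one_div, pow_add]

lemma ez_fib (m n : ℕ) (hm : 1 ≤ m) (hn : 2 ≤ n) :
    HasSum (fun k => ∑' i, ezAt m n k i) ((-1)^m * doubleZeta m n) := by
  have h := ((Equiv.prodComm ℕ ℕ).hasSum_iff).2 (ezD_summable m n hm hn).hasSum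
  rw [← ez_doubleZeta] at h
  have h2 := h.mul_left ((-1:ℝ)^m)
  refine h2.prod_fiberwise (fun k => ?_)
  have : (fun i => (-1:ℝ)^m * (ezD m n ∘ Equiv.prodComm ℕ ℕ) (k, i)) = ezAt m n k := by
    funext i
    have : ((-1:ℝ)^m)⁻¹ = (-1)^m := by rw [← inv_pow]; norm_num
    simp only [Function.comp, Equiv.prodComm_apply, Prod.swap, ezD, ezAt]
    rw [neg_pow ((i:ℝ)+1), mul_assoc ((-1:ℝ)^m), mul_inv ((-1:ℝ)^m), this, one_div, add_comm (i:ℝ) k]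
  rw [this]
  exact (ezAt_summable m n k (by omega)).hasSum

lemma ez_ge2 (m n w : ℕ) (hm : 2 ≤ m) (hn : 2 ≤ n) (hw : m + n = w) (hodd : Odd w) :
    doubleZeta m n ∈ ezS w := by
  obtain ⟨x, hx, hs⟩ := ez_main w (m+n) m n 0 rfl (by omega) (by omega) (by omega) (by omega)
  have hB : HasSum (fun k => ∑ j ∈ range k, ezBt m n k j) (zetaVal m * zetaVal n) := by
    have hs := (ez_summable m hm).mul_of_nonneg (ez_summable n hn)
      (fun i => by positivity) (fun i => by positivity)
    have h0 : HasSum (fun x : ℕ × ℕ => 1 / ((x.1:ℝ)+1)^m * (1 / ((x.2:ℝ)+1)^n))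
        (zetaVal m * zetaVal n) := (ez_hasSum m hm).mul (ez_hasSum n hn) hs
    refine ez_congr (ez_antidiag hs) (fun k => Finset.sum_congr rfl (fun j hj => ?_)) h0.tsum_eq.symm
    have hj := mem_range.1 hj
    have : ((k - 1 - j : ℕ) : ℝ) = (k:ℝ) - 1 - j := by
      rw [Nat.cast_sub (by omega), Nat.cast_sub (by omega)]; simp
    simp only [ezBt, this]
    rw [one_div_mul_one_div, one_div]
    ring_nf
  have hU := ((ez_fib m n (by omega) hn).add hB).add (ez_fib n m (by omega) hm)
  have hx2 := hs.unique (ez_congr hU (fun k => by simp [ezU]) rfl)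
  have hst := ez_stuffle m n hm hn
  rw [hw] at hst
  have hP := ezS_prod w m n hm hn hw
  have hZ := ezS_zeta w
  subst hw
  rcases Nat.even_or_odd m with hme | hmo
  · have hno : Odd n := by
      rcases Nat.even_or_odd n with h | h
      · exact absurd hodd (Nat.not_odd_iff_even.2 (hme.add h))
      · exact h
    rw [hme.neg_one_pow, hno.neg_one_pow] at hx2
    have : doubleZeta m n = ((1/2:ℚ):ℝ) * (x - zetaVal (m+n)) := by
      push_cast; linarith
    rw [this]
    exact ezS_smul _ _ ((ezS _).sub_mem hx hZ)
  · have hno : Even n := by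
      rcases Nat.even_or_odd n with h | h
      · exact h
      · exact absurd hodd (Nat.not_odd_iff_even.2 (hmo.add_odd h))
    rw [hmo.neg_one_pow, hno.neg_one_pow] at hx2
    have : doubleZeta m n = ((1/2:ℚ):ℝ) * (((2:ℚ):ℝ) * (zetaVal m * zetaVal n) - zetaVal (m+n) - x) := by
      push_cast; linarith
    rw [this]
    exact ezS_smul _ _ ((ezS _).sub_mem ((ezS _).sub_mem (ezS_smul _ _ hP) hZ) hx)

lemma ezT_tsum (N : ℕ) (hN : 1 ≤ N) :
    ∑' p, ezT N p = doubleZeta 1 (N+1) + zetaVal (N+2) := by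
  have h1 : HasSum (fun i : ℕ => ezH (i+1) / ((i:ℝ)+1)^(N+1)) (∑' p, ezT N p) := by
    refine (ezT_summable N hN).hasSum.prod_fiberwise (fun i => ?_)
    refine ez_congr ((ez_tele' i).div_const (((i:ℝ)+1)^N)) (fun j => ?_) ?_
    · simp only [ezT]
      rw [div_div, mul_comm]
    · rw [div_div, pow_succ']
  have h2 : HasSum (fun i : ℕ => ezH i / ((i:ℝ)+1)^(N+1)) (doubleZeta 1 (N+1)) := by
    rw [ez_doubleZeta]
    refine ez_congr (ez_antidiag (ezD_summable 1 (N+1) le_rfl (by omega))) (fun k => ?_) rfl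
    unfold ezH
    rw [Finset.sum_div]
    refine Finset.sum_congr rfl (fun j hj => ?_)
    have hj := mem_range.1 hj
    have : ((k - 1 - j : ℕ) : ℝ) = (k:ℝ) - 1 - j := by
      rw [Nat.cast_sub (by omega), Nat.cast_sub (by omega)]; simp
    simp only [ezD, this]
    rw [div_div, pow_one]
    ring_nf
  refine h1.unique (ez_congr (h2.add (ez_hasSum (N+2) (by omega))) (fun i => ?_) rfl)
  have : ezH (i+1) = ezH i + 1 / ((i:ℝ)+1) := by unfold ezH; rw [Finset.sum_range_succ]
  rw [this]
  field_simp
  ring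

lemma ez_geom (x y : ℝ) (hx : 0 < x) (hy : 0 < y) (N : ℕ) :
    ∑ a ∈ range N, 1 / (x^(a+1) * (x+y)^(N+1-a))
      = 1 / (x^N * (y * (x+y))) - 1 / (y * (x+y)^(N+1)) := by
  induction N with
  | zero => simp
  | succ N ih =>
    rw [Finset.sum_range_succ]
    have : ∑ a ∈ range N, 1 / (x^(a+1) * (x+y)^(N+1+1-a))
        = (∑ a ∈ range N, 1 / (x^(a+1) * (x+y)^(N+1-a))) / (x+y) := by
      rw [Finset.sum_div]
      refine Finset.sum_congr rfl (fun a ha => ?_)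
      have ha := mem_range.1 ha
      rw [show N+1+1-a = (N+1-a)+1 by omega, pow_succ (x+y), div_div, mul_assoc]
    rw [this, ih, show N+1+1-N = 2 by omega]
    field_simp
    ring

lemma ez_sumformula (N : ℕ) (hN : 1 ≤ N) :
    ∑ a ∈ range N, doubleZeta (a+1) (N+1-a) = zetaVal (N+2) := by
  have h1 : HasSum (fun p => ∑ a ∈ range N, ezD (a+1) (N+1-a) p)
      (∑ a ∈ range N, doubleZeta (a+1) (N+1-a)) := by
    refine hasSum_sum (fun a ha => ?_)
    have ha := mem_range.1 ha
    rw [ez_doubleZeta]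
    exact (ezD_summable _ _ (by omega) (by omega)).hasSum
  have h2 := ((Equiv.prodComm ℕ ℕ).hasSum_iff).2 (ezD_summable 1 (N+1) le_rfl (by omega)).hasSum
  rw [← ez_doubleZeta] at h2
  have h3 := (ezT_summable N hN).hasSum.sub h2
  rw [ezT_tsum N hN, add_sub_cancel_left] at h3
  refine h1.unique ?_
  refine ez_congr h3 (fun p => ?_) rfl
  have h := ez_geom ((p.1:ℝ)+1) ((p.2:ℝ)+1) (by positivity) (by positivity) N
  have e1 : (p.1:ℝ)+1 + (p.2+1) = (p.1:ℝ)+p.2+2 := by ring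
  rw [e1] at h
  simp only [ezD, ezT, Function.comp, Equiv.prodComm_apply, Prod.swap]
  rw [h, pow_one, add_comm (p.2:ℝ) p.1]

/-- Euler's theorem (weak form): for `n ≥ 2`, `m ≥ 1` with `n + m` odd, the double zeta
value `ζ(m,n)` lies in the `ℚ`-span of `ζ(n+m)` and the products `ζ(a)ζ(b)` with
`a + b = n + m`, `a, b ≥ 2`. -/
theorem euler_double_zeta (m n : ℕ) (hm : 1 ≤ m) (hn : 2 ≤ n) (hodd : Odd (n + m)) :
    doubleZeta m n ∈ Submodule.span ℚ
      ({zetaVal (n + m)} ∪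
        {x : ℝ | ∃ a b : ℕ, 2 ≤ a ∧ 2 ≤ b ∧ a + b = n + m ∧ x = zetaVal a * zetaVal b}) := by
  change doubleZeta m n ∈ ezS (n + m)
  rcases Nat.lt_or_ge m 2 with h | h
  · obtain rfl : m = 1 := by omega
    obtain ⟨N, rfl⟩ : ∃ N, n = N + 2 := ⟨n - 2, by omega⟩
    have hs := ez_sumformula (N+1) (by omega)
    rw [Finset.sum_range_succ'] at hs
    have e : doubleZeta 1 (N+2) = zetaVal (N+2+1)
        - ∑ a ∈ range N, doubleZeta (a+1+1) (N+1+1-(a+1)) := by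
      rw [eq_sub_iff_add_eq, add_comm]; exact hs
    rw [e]
    refine (ezS _).sub_mem (ezS_zeta _) ((ezS _).sum_mem (fun a ha => ?_))
    have ha := mem_range.1 ha
    exact ez_ge2 _ _ _ (by omega) (by omega) (by omega) hodd
  · exact ez_ge2 m n _ h hn (by omega) hodd
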